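/- Let a, b, c be real, let n ≥ k ≥ 0 be integers, and let (x,y) satisfy x > 0, y > 0, x + y < 1; write z = 1−x−y and W(x,y) = x^a·y^b·z^c·P_{n,k}^{(a,b,c)}(x,y). Then: −(2k+b+c+1)·∂W/∂x = x^{a−1}·y^b·z^{c−1}·[(k+c)(n−k+1)·P_{n+1,k}^{(a−1,b,c−1)}(x,y) + (k+1)(n−k+a)·P_{n+1,k+1}^{(a−1,b,c−1)}(x,y)]; ∂W/∂y = −(k+1)·x^a·y^{b−1}·z^{c−1}·P_{n+1,k+1}^{(a,b−1,c−1)}(x,y); and (2k+b+c+1)·(∂W/∂y − ∂W/∂x) = x^{a−1}·y^{b−1}·z^c·[(k+b)(n−k+1)·P_{n+1,k}^{(a−1,b−1,c)}(x,y) − (k+1)(n−k+a)·P_{n+1,k+1}^{(a−1,b−1,c)}(x,y)]. -/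

import Mathlib

noncomputable section

/-- Generalized binomial coefficient `C(α, j) = α(α−1)⋯(α−j+1)/j!`. -/
def genBinom (α : ℝ) (j : ℕ) : ℝ :=
  (∏ i ∈ Finset.range j, (α - i)) / (Nat.factorial j)

/-- Jacobi polynomial `P_n^{(a,b)}(x)`; zero for negative `n`. -/
def jacobiP (n : ℤ) (a b : ℝ) (x : ℝ) : ℝ :=
  if n < 0 then 0 else
    ∑ m ∈ Finset.range (n.toNat + 1),
      genBinom ((n : ℝ) + a) (n.toNat - m) * genBinom ((n : ℝ) + b) m *
        ((x - 1) / 2) ^ m * ((x + 1) / 2) ^ (n.toNat - m)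

/-- Four-parameter Koornwinder polynomial `P_{n,k}^{(a,b,c,d)}(x,y)`;
zero whenever `k < 0`, `n < 0`, or `k > n` (covering the conventions
`k = −1`, `n = −1`, `k = n+1`). -/
def koornP (n k : ℤ) (a b c d : ℝ) (x y : ℝ) : ℝ :=
  if n < 0 ∨ k < 0 ∨ n < k then 0 else
    jacobiP (n - k) (2 * (k : ℝ) + b + c + d + 1) a (2 * x - 1) *
      (1 - x) ^ k.toNat * jacobiP k c b (-1 + 2 * y / (1 - x))

theorem succ_mul_genBinom_succ (α : ℝ) (j : ℕ) :
    ((j : ℝ) + 1) * genBinom α (j + 1) = (α - j) * genBinom α j := by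
  have h1 : (Nat.factorial j : ℝ) ≠ 0 := by positivity
  have h2 : (j : ℝ) + 1 ≠ 0 := by positivity
  unfold genBinom
  rw [Finset.prod_range_succ, Nat.factorial_succ]
  push_cast
  field_simp

theorem succ_mul_genBinom_succ_eq_mul_pred (α : ℝ) (j : ℕ) :
    ((j : ℝ) + 1) * genBinom α (j + 1) = α * genBinom (α - 1) j := by
  have h1 : (Nat.factorial j : ℝ) ≠ 0 := by positivity
  have h2 : (j : ℝ) + 1 ≠ 0 := by positivity
  have h3 : ∏ i ∈ Finset.range j, (α - ((i + 1 : ℕ) : ℝ)) =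
      ∏ i ∈ Finset.range j, (α - 1 - i) :=
    Finset.prod_congr rfl fun i _ => by push_cast; ring
  unfold genBinom
  rw [Finset.prod_range_succ', Nat.factorial_succ, h3]
  push_cast
  field_simp
  ring

theorem genBinom_zero (α : ℝ) : genBinom α 0 = 1 := by simp [genBinom]

/-- Pascal's rule for generalized binomial coefficients. -/
theorem genBinom_succ_succ (α : ℝ) (j : ℕ) :
    genBinom (α + 1) (j + 1) = genBinom α (j + 1) + genBinom α j := by
  have h2 : (j : ℝ) + 1 ≠ 0 := by positivity
  have h3 := succ_mul_genBinom_succ_eq_mul_pred (α + 1) j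
  rw [add_sub_cancel_right] at h3
  refine mul_left_cancel₀ h2 ?_
  linear_combination h3 - succ_mul_genBinom_succ α j

/-- The homogeneous form `∑_{i+j=n} C(A, j) C(B, i) p^i q^j`. -/
def binomForm (A B : ℝ) (n : ℕ) (p q : ℝ) : ℝ :=
  ∑ ij ∈ Finset.HasAntidiagonal.antidiagonal n,
    genBinom A ij.2 * genBinom B ij.1 * p ^ ij.1 * q ^ ij.2

/-- The form `binomForm` of degree `n - 1`, zero for `n = 0`. -/
def binomFormPred (A B : ℝ) : ℕ → ℝ → ℝ → ℝ
  | 0, _, _ => 0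
  | n + 1, p, q => binomForm A B n p q

theorem binomForm_swap (A B : ℝ) (n : ℕ) (p q : ℝ) :
    binomForm A B n p q = binomForm B A n q p := by
  unfold binomForm
  rw [← Finset.Nat.sum_antidiagonal_swap]
  refine Finset.sum_congr rfl fun ij _ => ?_
  simp only [Prod.fst_swap, Prod.snd_swap]
  ring

theorem binomFormPred_swap (A B : ℝ) (n : ℕ) (p q : ℝ) :
    binomFormPred A B n p q = binomFormPred B A n q p := by
  cases n with
  | zero => rfl
  | succ n => exact binomForm_swap A B n p q

theorem binomForm_add_one_left (A B : ℝ) (n : ℕ) (p q : ℝ) :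
    binomForm (A + 1) B n p q = binomForm A B n p q + q * binomFormPred A B n p q := by
  cases n with
  | zero => simp [binomForm, binomFormPred, genBinom_zero]
  | succ n =>
    simp only [binomForm, binomFormPred, Finset.Nat.sum_antidiagonal_succ', genBinom_zero,
      genBinom_succ_succ, Finset.mul_sum, add_assoc, ← Finset.sum_add_distrib]
    congr 1
    exact Finset.sum_congr rfl fun ij _ => by ring

theorem binomForm_add_one_right (A B : ℝ) (n : ℕ) (p q : ℝ) :
    binomForm A (B + 1) n p q = binomForm A B n p q + p * binomFormPred A B n p q := by
  rw [binomForm_swap, binomForm_add_one_left, binomForm_swap, binomFormPred_swap]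

theorem sum_fst_mul_binomForm (A B : ℝ) (n : ℕ) (p q : ℝ) :
    ∑ ij ∈ Finset.HasAntidiagonal.antidiagonal n,
        genBinom A ij.2 * genBinom B ij.1 * (ij.1 * p ^ (ij.1 - 1)) * q ^ ij.2 =
      B * binomFormPred A (B - 1) n p q := by
  cases n with
  | zero => simp [binomFormPred]
  | succ n =>
    rw [Finset.Nat.sum_antidiagonal_succ]
    simp only [binomForm, binomFormPred, Finset.mul_sum]
    rw [Nat.cast_zero, zero_mul, mul_zero, zero_mul, zero_add]
    refine Finset.sum_congr rfl fun ij _ => ?_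
    have h := succ_mul_genBinom_succ_eq_mul_pred B ij.1
    push_cast
    linear_combination genBinom A ij.2 * p ^ ij.1 * q ^ ij.2 * h

theorem sum_snd_mul_binomForm (A B : ℝ) (n : ℕ) (p q : ℝ) :
    ∑ ij ∈ Finset.HasAntidiagonal.antidiagonal n,
        genBinom A ij.2 * genBinom B ij.1 * p ^ ij.1 * (ij.2 * q ^ (ij.2 - 1)) =
      A * binomFormPred (A - 1) B n p q := by
  rw [binomFormPred_swap, ← sum_fst_mul_binomForm, ← Finset.Nat.sum_antidiagonal_swap]
  refine Finset.sum_congr rfl fun ij _ => ?_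
  simp only [Prod.fst_swap, Prod.snd_swap]
  ring

/-- Euler's identity for the homogeneous form `binomForm`. -/
theorem natCast_mul_binomForm (A B : ℝ) (n : ℕ) (p q : ℝ) :
    n * binomForm A B n p q =
      p * (B * binomFormPred A (B - 1) n p q) + q * (A * binomFormPred (A - 1) B n p q) := by
  have hpow (r : ℝ) (i : ℕ) : r * (i * r ^ (i - 1)) = i * r ^ i := by
    cases i with
    | zero => simp
    | succ i => rw [Nat.add_sub_cancel, pow_succ]; ring
  rw [← sum_fst_mul_binomForm, ← sum_snd_mul_binomForm, binomForm]
  simp only [Finset.mul_sum, ← Finset.sum_add_distrib]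
  refine Finset.sum_congr rfl fun ij hij => ?_
  have h : (n : ℝ) = ij.1 + ij.2 := by
    exact_mod_cast (Finset.HasAntidiagonal.mem_antidiagonal.mp hij).symm
  rw [h]
  linear_combination -(genBinom A ij.2 * genBinom B ij.1 * q ^ ij.2) * hpow p ij.1 -
    genBinom A ij.2 * genBinom B ij.1 * p ^ ij.1 * hpow q ij.2

theorem succ_mul_binomForm_succ (A B : ℝ) (n : ℕ) (p q : ℝ) :
    ((n : ℝ) + 1) * binomForm A B (n + 1) p q =
      p * (B * binomForm A (B - 1) n p q) + q * (A * binomForm (A - 1) B n p q) := by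
  exact_mod_cast natCast_mul_binomForm A B (n + 1) p q

theorem sub_mul_binomForm_left (A B : ℝ) (n : ℕ) (p q : ℝ) :
    (A - n) * binomForm A B n p q + p * (B * binomFormPred A (B - 1) n p q) =
      A * binomForm (A - 1) B n p q := by
  have h := binomForm_add_one_left (A - 1) B n p q
  rw [sub_add_cancel] at h
  linear_combination A * h - natCast_mul_binomForm A B n p q

theorem sub_mul_binomForm_right (A B : ℝ) (n : ℕ) (p q : ℝ) :
    (B - n) * binomForm A B n p q + q * (A * binomFormPred (A - 1) B n p q) =
      B * binomForm A (B - 1) n p q := by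
  rw [binomForm_swap, binomFormPred_swap, sub_mul_binomForm_left, binomForm_swap]

theorem sub_mul_binomForm_add_mul_deriv (A B : ℝ) (n : ℕ) (p q : ℝ) :
    (B - n) * binomForm A B n p q +
        q * (B * binomFormPred A (B - 1) n p q + A * binomFormPred (A - 1) B n p q) =
      B * binomForm (A + 1) (B - 1) n p q := by
  linear_combination sub_mul_binomForm_right A B n p q -
    B * binomForm_add_one_left A (B - 1) n p q

theorem succ_mul_binomForm_succ_eq_sub_mul (A B : ℝ) (n : ℕ) (p q : ℝ) :
    ((n : ℝ) + 1) * binomForm A B (n + 1) p q =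
      (A - n) * q * binomForm A B n p q + p * (B * binomForm (A + 1) (B - 1) n p q) := by
  rw [succ_mul_binomForm_succ, ← sub_mul_binomForm_left]
  linear_combination -(p * B) * binomForm_add_one_left A (B - 1) n p q

theorem succ_mul_binomForm_succ_add_one_right (A B : ℝ) (n : ℕ) (p q : ℝ) :
    ((n : ℝ) + 1) * binomForm A (B + 1) (n + 1) p q =
      A * (q - p) * binomForm (A - 1) B n p q + (A + B + 1) * p * binomForm A B n p q := by
  have h := binomForm_add_one_left (A - 1) B n p q
  rw [sub_add_cancel] at h
  rw [succ_mul_binomForm_succ, add_sub_cancel_right, binomForm_add_one_right]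
  linear_combination -(A * p) * h

theorem succ_mul_binomForm_succ_add_one_left (A B : ℝ) (n : ℕ) (p q : ℝ) :
    ((n : ℝ) + 1) * binomForm (A + 1) B (n + 1) p q =
      B * (p - q) * binomForm A (B - 1) n p q + (A + B + 1) * q * binomForm A B n p q := by
  rw [binomForm_swap, succ_mul_binomForm_succ_add_one_right, binomForm_swap (B - 1),
    binomForm_swap B A]
  ring

theorem hasDerivAt_binomForm (A B : ℝ) (n : ℕ) {f g : ℝ → ℝ} {f' g' t : ℝ}
    (hf : HasDerivAt f f' t) (hg : HasDerivAt g g' t) :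
    HasDerivAt (fun s => binomForm A B n (f s) (g s))
      (B * binomFormPred A (B - 1) n (f t) (g t) * f' +
        A * binomFormPred (A - 1) B n (f t) (g t) * g') t := by
  rw [← sum_fst_mul_binomForm, ← sum_snd_mul_binomForm, Finset.sum_mul, Finset.sum_mul,
    ← Finset.sum_add_distrib]
  unfold binomForm
  refine HasDerivAt.fun_sum fun ij _ => ?_
  refine (((hf.fun_pow ij.1).const_mul (genBinom A ij.2 * genBinom B ij.1)).fun_mul
    (hg.fun_pow ij.2)).congr_deriv ?_
  ring

theorem jacobiP_natCast (n : ℕ) (a b x : ℝ) :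
    jacobiP n a b x = binomForm (n + a) (n + b) n ((x - 1) / 2) ((x + 1) / 2) := by
  rw [jacobiP, if_neg (by omega), binomForm,
    Finset.Nat.sum_antidiagonal_eq_sum_range_succ_mk]
  simp

theorem binomForm_mul_mul (A B : ℝ) (n : ℕ) (t p q : ℝ) :
    binomForm A B n (t * p) (t * q) = t ^ n * binomForm A B n p q := by
  unfold binomForm
  rw [Finset.mul_sum]
  refine Finset.sum_congr rfl fun ij hij => ?_
  simp only [← Finset.HasAntidiagonal.mem_antidiagonal.mp hij, mul_pow, pow_add]
  ring

theorem koornP_natCast_add (N k : ℕ) (a b c d : ℝ) {x : ℝ} (y : ℝ) (hx : x ≠ 1) :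
    koornP ((k : ℤ) + N) k a b c d x y =
      binomForm (N + (2 * k + b + c + d + 1)) (N + a) N (x - 1) x *
        binomForm (k + c) (k + b) k (x + y - 1) y := by
  have hx' : 1 - x ≠ 0 := sub_ne_zero.mpr hx.symm
  have h : x + y - 1 = (1 - x) * ((-1 + 2 * y / (1 - x) - 1) / 2) := by field_simp; ring
  have h' : (1 - x) * ((-1 + 2 * y / (1 - x) + 1) / 2) = y := by field_simp; ring
  have h'' := binomForm_mul_mul (k + c) (k + b) k (1 - x)
    ((-1 + 2 * y / (1 - x) - 1) / 2) ((-1 + 2 * y / (1 - x) + 1) / 2)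
  rw [← h, h'] at h''
  rw [koornP, if_neg (by omega), add_sub_cancel_left, jacobiP_natCast, jacobiP_natCast, h'',
    Int.toNat_natCast, Int.cast_natCast,
    show (2 * x - 1 - 1) / 2 = x - 1 by ring, show (2 * x - 1 + 1) / 2 = x by ring]
  ring

theorem rpow_eq_rpow_sub_one_mul {x : ℝ} (hx : 0 < x) (a : ℝ) : x ^ a = x ^ (a - 1) * x := by
  rw [Real.rpow_sub_one hx.ne', div_mul_cancel₀ _ hx.ne']

theorem hasDerivAt_rpow_mul_koornP_fst (N k : ℕ) (a b c : ℝ) {x y : ℝ} (hx : 0 < x)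
    (hx1 : x ≠ 1) (hxy : x + y < 1) :
    HasDerivAt (fun x' => x' ^ a * y ^ b * (1 - x' - y) ^ c
        * koornP ((k : ℤ) + N) k a b c 0 x' y)
      (x ^ (a - 1) * y ^ b * (1 - x - y) ^ (c - 1) *
        ((N + a) * binomForm (N + (2 * k + b + c + 1) + 1) (N + a - 1) N (x - 1) x *
            ((1 - x - y) * binomForm (k + c) (k + b) k (x + y - 1) y) -
          x * binomForm (N + (2 * k + b + c + 1)) (N + a) N (x - 1) x *
            ((k + c) * binomForm (k + c - 1) (k + b) k (x + y - 1) y))) x := by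
  have hz : 0 < 1 - x - y := by linarith
  have hxa : x ^ a = x ^ (a - 1) * x := rpow_eq_rpow_sub_one_mul hx a
  have hzc : (1 - x - y) ^ c = (1 - x - y) ^ (c - 1) * (1 - x - y) :=
    rpow_eq_rpow_sub_one_mul hz c
  have hev : (fun x' => x' ^ a * y ^ b * (1 - x' - y) ^ c
      * koornP ((k : ℤ) + N) k a b c 0 x' y) =ᶠ[nhds x] fun x' =>
      x' ^ a * y ^ b * (1 - x' - y) ^ c *
        (binomForm (N + (2 * k + b + c + 1)) (N + a) N (x' - 1) x' *
          binomForm (k + c) (k + b) k (x' + y - 1) y) := by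
    filter_upwards [isOpen_ne.mem_nhds hx1] with x' hx'
    rw [koornP_natCast_add _ _ _ _ _ _ _ hx', add_zero]
  refine HasDerivAt.congr_of_eventuallyEq ?_ hev
  refine HasDerivAt.congr_deriv
    ((((Real.hasDerivAt_rpow_const (Or.inl hx.ne')).mul_const (y ^ b)).fun_mul
    ((((hasDerivAt_id' x).const_sub 1).sub_const y).rpow_const (Or.inl hz.ne'))).fun_mul
    ((hasDerivAt_binomForm _ _ _ ((hasDerivAt_id' x).sub_const 1) (hasDerivAt_id' x)).fun_mul
    (hasDerivAt_binomForm _ _ _ (((hasDerivAt_id' x).add_const y).sub_const 1)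
      (hasDerivAt_const x y)))) ?_
  have hA := sub_mul_binomForm_add_mul_deriv (N + (2 * k + b + c + 1)) (N + a) N (x - 1) x
  have hK := sub_mul_binomForm_left (k + c) (k + b) k (x + y - 1) y
  rw [← hA, ← hK, hxa, hzc]
  ring

theorem hasDerivAt_rpow_mul_koornP_snd (N k : ℕ) (a b c : ℝ) {x y : ℝ} (hx : x ≠ 1)
    (hy : 0 < y) (hxy : x + y < 1) :
    HasDerivAt (fun y' => x ^ a * y' ^ b * (1 - x - y') ^ c
        * koornP ((k : ℤ) + N) k a b c 0 x y')
      (-((k : ℝ) + 1) * x ^ a * y ^ (b - 1) * (1 - x - y) ^ (c - 1) *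
        (binomForm (N + (2 * k + b + c + 1)) (N + a) N (x - 1) x *
          binomForm (k + c) (k + b) (k + 1) (x + y - 1) y)) y := by
  have hz : 0 < 1 - x - y := by linarith
  have hyb : y ^ b = y ^ (b - 1) * y := rpow_eq_rpow_sub_one_mul hy b
  have hzc : (1 - x - y) ^ c = (1 - x - y) ^ (c - 1) * (1 - x - y) :=
    rpow_eq_rpow_sub_one_mul hz c
  simp_rw [koornP_natCast_add _ _ _ _ _ _ _ hx, add_zero]
  refine HasDerivAt.congr_deriv
    ((((Real.hasDerivAt_rpow_const (Or.inl hy.ne')).const_mul (x ^ a)).fun_mul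
    (((hasDerivAt_id' y).const_sub (1 - x)).rpow_const (Or.inl hz.ne'))).fun_mul
    ((hasDerivAt_binomForm _ _ _ (((hasDerivAt_id' y).const_add x).sub_const 1)
      (hasDerivAt_id' y)).const_mul _)) ?_
  have h := succ_mul_binomForm_succ (k + c) (k + b) k (x + y - 1) y
  rw [← sub_mul_binomForm_left, ← sub_mul_binomForm_right] at h
  rw [hyb, hzc]
  linear_combination (x ^ a * y ^ (b - 1) * (1 - x - y) ^ (c - 1) *
    binomForm (N + (2 * k + b + c + 1)) (N + a) N (x - 1) x) * h

theorem koorn_weighted_differentiation (a b c : ℝ) (n k : ℤ) (hk : 0 ≤ k)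
    (hnk : k ≤ n) (x y : ℝ) (hx : 0 < x) (hy : 0 < y) (hxy : x + y < 1) :
    (-((2 * (k : ℝ) + b + c + 1)
        * deriv (fun x' => x' ^ a * y ^ b * (1 - x' - y) ^ c
            * koornP n k a b c 0 x' y) x)
      = x ^ (a - 1) * y ^ b * (1 - x - y) ^ (c - 1)
          * (((k : ℝ) + c) * ((n : ℝ) - (k : ℝ) + 1)
              * koornP (n + 1) k (a - 1) b (c - 1) 0 x y
            + ((k : ℝ) + 1) * ((n : ℝ) - (k : ℝ) + a)
              * koornP (n + 1) (k + 1) (a - 1) b (c - 1) 0 x y)) ∧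
    (deriv (fun y' => x ^ a * y' ^ b * (1 - x - y') ^ c
        * koornP n k a b c 0 x y') y
      = -((k : ℝ) + 1) * x ^ a * y ^ (b - 1) * (1 - x - y) ^ (c - 1)
          * koornP (n + 1) (k + 1) a (b - 1) (c - 1) 0 x y) ∧
    ((2 * (k : ℝ) + b + c + 1)
        * (deriv (fun y' => x ^ a * y' ^ b * (1 - x - y') ^ c
              * koornP n k a b c 0 x y') y
          - deriv (fun x' => x' ^ a * y ^ b * (1 - x' - y) ^ c
              * koornP n k a b c 0 x' y) x)
      = x ^ (a - 1) * y ^ (b - 1) * (1 - x - y) ^ c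
          * (((k : ℝ) + b) * ((n : ℝ) - (k : ℝ) + 1)
              * koornP (n + 1) k (a - 1) (b - 1) c 0 x y
            - ((k : ℝ) + 1) * ((n : ℝ) - (k : ℝ) + a)
              * koornP (n + 1) (k + 1) (a - 1) (b - 1) c 0 x y)) := by
  lift k to ℕ using hk
  obtain ⟨N, rfl⟩ : ∃ N : ℕ, n = (k : ℤ) + N := ⟨(n - k).toNat, by omega⟩
  have hx1 : x ≠ 1 := by linarith
  have hz : 0 < 1 - x - y := by linarith
  have hsucc : (k : ℤ) + N + 1 = (k : ℤ) + ((N + 1 : ℕ) : ℤ) := by push_cast; ring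
  have hsucc' : (k : ℤ) + N + 1 = ((k + 1 : ℕ) : ℤ) + (N : ℤ) := by push_cast; ring
  have hx_same : koornP ((k : ℤ) + N + 1) k (a - 1) b (c - 1) 0 x y =
      binomForm (N + (2 * k + b + c + 1)) (N + a) (N + 1) (x - 1) x *
        binomForm (k + c - 1) (k + b) k (x + y - 1) y := by
    rw [hsucc, koornP_natCast_add _ _ _ _ _ _ _ hx1]
    congr 2 <;> push_cast <;> ring
  have hx_succ : koornP ((k : ℤ) + N + 1) (k + 1) (a - 1) b (c - 1) 0 x y =
      binomForm (N + (2 * k + b + c + 1) + 1) (N + a - 1) N (x - 1) x *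
        binomForm (k + c) (k + b + 1) (k + 1) (x + y - 1) y := by
    rw [hsucc', ← Nat.cast_succ, koornP_natCast_add _ _ _ _ _ _ _ hx1]
    congr 2 <;> push_cast <;> ring
  have hy_succ : koornP ((k : ℤ) + N + 1) (k + 1) a (b - 1) (c - 1) 0 x y =
      binomForm (N + (2 * k + b + c + 1)) (N + a) N (x - 1) x *
        binomForm (k + c) (k + b) (k + 1) (x + y - 1) y := by
    rw [hsucc', ← Nat.cast_succ, koornP_natCast_add _ _ _ _ _ _ _ hx1]
    congr 2 <;> push_cast <;> ring
  have hz_same : koornP ((k : ℤ) + N + 1) k (a - 1) (b - 1) c 0 x y =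
      binomForm (N + (2 * k + b + c + 1)) (N + a) (N + 1) (x - 1) x *
        binomForm (k + c) (k + b - 1) k (x + y - 1) y := by
    rw [hsucc, koornP_natCast_add _ _ _ _ _ _ _ hx1]
    congr 2 <;> push_cast <;> ring
  have hz_succ : koornP ((k : ℤ) + N + 1) (k + 1) (a - 1) (b - 1) c 0 x y =
      binomForm (N + (2 * k + b + c + 1) + 1) (N + a - 1) N (x - 1) x *
        binomForm (k + c + 1) (k + b) (k + 1) (x + y - 1) y := by
    rw [hsucc', ← Nat.cast_succ, koornP_natCast_add _ _ _ _ _ _ _ hx1]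
    congr 2 <;> push_cast <;> ring
  have hJ := succ_mul_binomForm_succ_eq_sub_mul (N + (2 * k + b + c + 1)) (N + a) N (x - 1) x
  have hK := succ_mul_binomForm_succ_add_one_right (k + c) (k + b) k (x + y - 1) y
  have hK' := succ_mul_binomForm_succ_add_one_left (k + c) (k + b) k (x + y - 1) y
  have hL := succ_mul_binomForm_succ (k + c) (k + b) k (x + y - 1) y
  rw [(hasDerivAt_rpow_mul_koornP_fst N k a b c hx hx1 hxy).deriv,
    (hasDerivAt_rpow_mul_koornP_snd N k a b c hx1 hy hxy).deriv, hx_same, hx_succ, hy_succ,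
    hz_same, hz_succ, rpow_eq_rpow_sub_one_mul hx a, rpow_eq_rpow_sub_one_mul hy b,
    rpow_eq_rpow_sub_one_mul hz c]
  push_cast
  set F := binomForm (N + (2 * k + b + c + 1)) (N + a) N (x - 1) x
  set J := binomForm (N + (2 * k + b + c + 1) + 1) (N + a - 1) N (x - 1) x
  set K := binomForm (k + c - 1) (k + b) k (x + y - 1) y
  set K' := binomForm (k + c) (k + b - 1) k (x + y - 1) y
  set w := x ^ (a - 1) * y ^ (b - 1) * (1 - x - y) ^ (c - 1)
  refine ⟨?_, by ring, ?_⟩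
  · linear_combination -(w * y) * ((k + c) * K * hJ + (N + a) * J * hK)
  · linear_combination -(2 * (k : ℝ) + b + c + 1) * (w * x * F) * hL -
      w * (1 - x - y) * ((k + b) * K' * hJ - (N + a) * J * hK')
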